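/- Assume the chain is transient, i.e. D(0,∞) < ∞. Then for every R = 0,1,2,… and every L = 1,2,…, P( ξ(R,∞,↑) = L ) = (1/D(R,∞)) (1 − 1/D(R,∞))^{L−1}; that is, the total number of upcrossings at R is geometrically distributed with parameter 1/D(R,∞). Moreover, the sequence (ξ(R,∞,↑))_{R=0,1,2,…} is a Markov chain. -/

import Mathlib

open MeasureTheory Filter Finset
open scoped ENNReal NNReal Topology

noncomputable section

namespace NNRW

/-- Probability of a step to the right from site `i`: `E 0 = 1`, `E i = 1/2 + p i` for `i ≥ 1`. -/
def E (p : ℕ → ℝ) (i : ℕ) : ℝ := if i = 0 then 1 else 1 / 2 + p i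

/-- One-step transition probability of the nearest-neighbour walk, from `i` to `j`. -/
def step (p : ℕ → ℝ) (i j : ℕ) : ℝ :=
  if j = i + 1 then E p i else if j + 1 = i then 1 - E p i else 0

/-- `X` is (distributed as) the nearest-neighbour Markov chain with parameters `p`, started
at `b`, under the probability measure `P`: `X 0 = b` and the finite-dimensional
distributions are the products of the one-step transition probabilities. -/
def IsNNWalk {Ω : Type*} [MeasurableSpace Ω] (P : Measure Ω)
    (X : ℕ → Ω → ℕ) (p : ℕ → ℝ) (b : ℕ) : Prop :=
  (∀ ω, X 0 ω = b) ∧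
    ∀ (n : ℕ) (u : ℕ → ℕ), u 0 = b →
      P {ω | ∀ k ≤ n, X k ω = u k} =
        ENNReal.ofReal (∏ k ∈ Finset.range n, step p (u k) (u (k + 1)))

/-- `U i = (1/2 - p i)/(1/2 + p i)`. -/
def U (p : ℕ → ℝ) (i : ℕ) : ℝ := (1 / 2 - p i) / (1 / 2 + p i)

/-- `D(m,n)` for finite `m ≤ n`. -/
def Dfin (p : ℕ → ℝ) (m n : ℕ) : ℝ :=
  if n = m then 0
  else 1 + ∑ j ∈ Finset.Icc 1 (n - m - 1), ∏ i ∈ Finset.Icc 1 j, U p (m + i)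

/-- `D(m,∞) = lim_{n → ∞} D(m,n) ∈ (0,∞]`. -/
def Dinf (p : ℕ → ℝ) (m : ℕ) : ℝ≥0∞ :=
  1 + ∑' j : ℕ, ENNReal.ofReal (∏ i ∈ Finset.Icc 1 (j + 1), U p (m + i))

/-- Event: the walk visits `a` (strictly) before it ever visits `c`. -/
def hitsBefore {Ω : Type*} (X : ℕ → Ω → ℕ) (a c : ℕ) : Set Ω :=
  {ω | ∃ n, X n ω = a ∧ ∀ k < n, X k ω ≠ c}

/-- Event: the walk ever visits `a`. -/
def hits {Ω : Type*} (X : ℕ → Ω → ℕ) (a : ℕ) : Set Ω := {ω | ∃ n, X n ω = a}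

/-- Total local time `ξ(x,∞)` at site `x` (equal to `∞` if there are infinitely many
visits). -/
def localTime {Ω : Type*} (X : ℕ → Ω → ℕ) (x : ℕ) (ω : Ω) : ℝ≥0∞ :=
  ∑' k : ℕ, Set.indicator {k | X k ω = x} (fun _ => (1 : ℝ≥0∞)) k

/-- Total number of upcrossings `ξ(x,∞,↑)` at site `x`. -/
def upcross {Ω : Type*} (X : ℕ → Ω → ℕ) (x : ℕ) (ω : Ω) : ℝ≥0∞ :=
  ∑' k : ℕ, Set.indicator {k | X k ω = x ∧ X (k + 1) ω = x + 1} (fun _ => (1 : ℝ≥0∞)) k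

/-- Iterated logarithm: `iterLog 0 x = x`, `iterLog (k+1) x = log (iterLog k x)`. -/
def iterLog : ℕ → ℝ → ℝ
  | 0, x => x
  | k + 1, x => Real.log (iterLog k x)

/-- `λ(k,x)`: `lam 0 x = 1`, `lam (k+1) x = lam k x * log_k x`. -/
def lam : ℕ → ℝ → ℝ
  | 0, _ => 1
  | k + 1, x => lam k x * iterLog k x

/-- `Λ(K,x,B) = Λ(K-1,x) + B/λ(K,x)` where `Λ(K,x) = ∑_{k=1}^{K} 1/λ(k,x)`. -/
def LamB (K : ℕ) (B : ℝ) (x : ℝ) : ℝ :=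
  (∑ k ∈ Finset.Icc 1 (K - 1), 1 / lam k x) + B / lam K x

/-- The truncation convention: with `i₀ = min{i ≥ 1 : q i < 1/2}` one has `p i = q i₀`
for `1 ≤ i ≤ i₀` and `p i = q i` for `i > i₀`. -/
def IsTruncation (q p : ℕ → ℝ) : Prop :=
  ∃ i0 : ℕ, 1 ≤ i0 ∧ q i0 < 1 / 2 ∧ (∀ i, 1 ≤ i → i < i0 → ¬ q i < 1 / 2) ∧
    (∀ i, 1 ≤ i → i ≤ i0 → p i = q i0) ∧ ∀ i, i0 < i → p i = q i

end NNRW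

open NNRW

namespace NNRW

/-! ### Escape probabilities -/

/-- The products `∏_{i=1}^{j} U (R + i)`. -/
def ratioProd (p : ℕ → ℝ) (R j : ℕ) : ℝ := ∏ i ∈ Finset.Icc 1 j, U p (R + i)

/-- The probability that the walk started at `x` never visits `R`, for `x ≥ R`
(and `0` for `x ≤ R`). -/
def escape (p : ℕ → ℝ) (R x : ℕ) : ℝ :=
  (∑ j ∈ Finset.range (x - R), ratioProd p R j) / ∑' j, ratioProd p R j

section Escape

variable {p : ℕ → ℝ}

theorem U_pos (hp : ∀ i, 1 ≤ i → 0 ≤ p i ∧ p i < 1 / 2) {i : ℕ} (hi : 1 ≤ i) : 0 < U p i := by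
  obtain ⟨h0, h1⟩ := hp i hi
  unfold U
  apply div_pos <;> linarith

theorem E_nonneg (hp : ∀ i, 1 ≤ i → 0 ≤ p i ∧ p i < 1 / 2) (i : ℕ) : 0 ≤ E p i := by
  unfold E
  split_ifs with h
  · norm_num
  · linarith [(hp i (by lia)).1]

theorem E_le_one (hp : ∀ i, 1 ≤ i → 0 ≤ p i ∧ p i < 1 / 2) (i : ℕ) : E p i ≤ 1 := by
  unfold E
  split_ifs with h
  · norm_num
  · linarith [(hp i (by lia)).2]

theorem E_succ_lt_one (hp : ∀ i, 1 ≤ i → 0 ≤ p i ∧ p i < 1 / 2) (i : ℕ) : E p (i + 1) < 1 := by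
  simp only [E, Nat.succ_ne_zero, if_false]
  linarith [(hp (i + 1) (by lia)).2]

theorem E_mul_U (hp : ∀ i, 1 ≤ i → 0 ≤ p i ∧ p i < 1 / 2) {i : ℕ} (hi : 1 ≤ i) :
    E p i * U p i = 1 - E p i := by
  obtain ⟨h0, h1⟩ := hp i hi
  have : (1 / 2 + p i) ≠ 0 := by linarith
  simp only [E, U, Nat.ne_of_gt hi, if_false]
  field_simp
  ring

theorem ratioProd_zero (R : ℕ) : ratioProd p R 0 = 1 := by simp [ratioProd]

theorem ratioProd_succ (R j : ℕ) :
    ratioProd p R (j + 1) = ratioProd p R j * U p (R + (j + 1)) := by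
  simp [ratioProd, Finset.prod_Icc_succ_top]

theorem ratioProd_pos (hp : ∀ i, 1 ≤ i → 0 ≤ p i ∧ p i < 1 / 2) (R j : ℕ) :
    0 < ratioProd p R j :=
  Finset.prod_pos fun i hi => U_pos hp (by have := (Finset.mem_Icc.1 hi).1; lia)

theorem ratioProd_add (R j : ℕ) :
    ratioProd p 0 (R + j) = ratioProd p 0 R * ratioProd p R j := by
  induction j with
  | zero => simp [ratioProd_zero]
  | succ j ih => rw [← add_assoc, ratioProd_succ, ih, ratioProd_succ, zero_add, mul_assoc, add_assoc]

theorem summable_ratioProd (hp : ∀ i, 1 ≤ i → 0 ≤ p i ∧ p i < 1 / 2) (htrans : Dinf p 0 < ⊤)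
    (R : ℕ) : Summable (ratioProd p R) := by
  have h0 : Summable (ratioProd p 0) := by
    rw [← summable_nat_add_iff 1]
    have h := ENNReal.summable_toReal (ENNReal.add_lt_top.1 htrans).2.ne
    refine h.congr fun j => ?_
    exact ENNReal.toReal_ofReal (ratioProd_pos hp 0 (j + 1)).le
  have h1 : Summable fun j => ratioProd p 0 (R + j) := by
    simpa only [add_comm] using (summable_nat_add_iff R).2 h0
  simp_rw [ratioProd_add] at h1
  exact (summable_mul_left_iff (ratioProd_pos hp 0 R).ne').1 h1

theorem Dinf_eq (hp : ∀ i, 1 ≤ i → 0 ≤ p i ∧ p i < 1 / 2) (htrans : Dinf p 0 < ⊤) (R : ℕ) :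
    Dinf p R = ENNReal.ofReal (∑' j, ratioProd p R j) := by
  have hs := summable_ratioProd hp htrans R
  rw [hs.tsum_eq_zero_add, ratioProd_zero,
    ENNReal.ofReal_add zero_le_one (tsum_nonneg fun j => (ratioProd_pos hp R _).le),
    ENNReal.ofReal_one, ENNReal.ofReal_tsum_of_nonneg (fun j => (ratioProd_pos hp R _).le)
      ((summable_nat_add_iff 1).2 hs)]
  rfl

theorem tsum_ratioProd_pos (hp : ∀ i, 1 ≤ i → 0 ≤ p i ∧ p i < 1 / 2) (htrans : Dinf p 0 < ⊤)
    (R : ℕ) : 0 < ∑' j, ratioProd p R j :=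
  (summable_ratioProd hp htrans R).tsum_pos (fun j => (ratioProd_pos hp R j).le) 0
    (ratioProd_pos hp R 0)

theorem escape_of_le {R x : ℕ} (h : x ≤ R) : escape p R x = 0 := by
  simp [escape, Nat.sub_eq_zero_of_le h]

theorem escape_nonneg (hp : ∀ i, 1 ≤ i → 0 ≤ p i ∧ p i < 1 / 2) (R x : ℕ) : 0 ≤ escape p R x :=
  div_nonneg (Finset.sum_nonneg fun j _ => (ratioProd_pos hp R j).le)
    (tsum_nonneg fun j => (ratioProd_pos hp R j).le)

theorem escape_le_one (hp : ∀ i, 1 ≤ i → 0 ≤ p i ∧ p i < 1 / 2) (htrans : Dinf p 0 < ⊤)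
    (R x : ℕ) : escape p R x ≤ 1 :=
  div_le_one_of_le₀ ((summable_ratioProd hp htrans R).sum_le_tsum _
    fun j _ => (ratioProd_pos hp R j).le) (tsum_ratioProd_pos hp htrans R).le

theorem escape_succ_self (R : ℕ) : escape p R (R + 1) = 1 / ∑' j, ratioProd p R j := by
  simp [escape, ratioProd_zero]

theorem escape_harmonic (hp : ∀ i, 1 ≤ i → 0 ≤ p i ∧ p i < 1 / 2) {R x : ℕ} (h : R < x) :
    escape p R x = E p x * escape p R (x + 1) + (1 - E p x) * escape p R (x - 1) := by
  obtain ⟨t, rfl⟩ : ∃ t, x = R + (t + 1) := ⟨x - R - 1, by lia⟩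
  have e1 : R + (t + 1) - R = t + 1 := by lia
  have e2 : R + (t + 1) + 1 - R = t + 1 + 1 := by lia
  have e3 : R + (t + 1) - 1 - R = t := by lia
  have hU := E_mul_U hp (i := R + (t + 1)) (by lia)
  simp only [escape, e1, e2, e3, Finset.sum_range_succ, ratioProd_succ]
  simp only [div_eq_mul_inv]
  linear_combination
    (-ratioProd p R t * (∑' j, ratioProd p R j)⁻¹) * hU

theorem tendsto_escape (hp : ∀ i, 1 ≤ i → 0 ≤ p i ∧ p i < 1 / 2) (htrans : Dinf p 0 < ⊤)
    (R : ℕ) : Tendsto (escape p R) atTop (𝓝 1) := by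
  have h := ((summable_ratioProd hp htrans R).hasSum.tendsto_sum_nat.comp
    (tendsto_sub_atTop_nat R)).div_const (∑' j, ratioProd p R j)
  rwa [div_self (tsum_ratioProd_pos hp htrans R).ne'] at h

end Escape

/-! ### The harmonic function of the walk together with its remaining upcrossings -/

/-- The total weight of the arrangements of `a` steps to the right and `b` steps to the left
taken from `s`, the last of which is to the right. -/
def arrangementWeight (p : ℕ → ℝ) (s a b : ℕ) : ℝ :=
  a.multichoose b * E p s ^ a * (1 - E p s) ^ b

/-- The weight of the steps from `s` for a walk at `x` which still has to make `a` upcrossings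
at `s` and `b` upcrossings at `s - 1`. -/
def siteWeight (p : ℕ → ℝ) (s a b x : ℕ) : ℝ :=
  if s ≤ x then arrangementWeight p s a b
  else if b = 0 then 0 else arrangementWeight p s a (b - 1)

/-- The probability that the walk started at `x` makes exactly `w` upcrossings at `R`. -/
def lastWeight (p : ℕ → ℝ) (R x w : ℕ) : ℝ :=
  if w = 0 then escape p R x
  else (1 - escape p R x) * (escape p R (R + 1) * (1 - escape p R (R + 1)) ^ (w - 1))

/-- The probability that the walk started at `x` makes exactly `w r` upcrossings at each
`r ∈ [m, R]`. -/
def upcrossProb (p : ℕ → ℝ) (m R x : ℕ) (w : ℕ → ℕ) : ℝ :=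
  lastWeight p R x (w R) * ∏ s ∈ Finset.Ioc m R, siteWeight p s (w s) (w (s - 1)) x

section Harmonic

variable {p : ℕ → ℝ}

theorem arrangementWeight_zero_zero (s : ℕ) : arrangementWeight p s 0 0 = 1 := by
  simp [arrangementWeight]

theorem arrangementWeight_zero_succ (s b : ℕ) : arrangementWeight p s 0 (b + 1) = 0 := by
  simp [arrangementWeight]

theorem arrangementWeight_succ (s a b : ℕ) :
    arrangementWeight p s (a + 1) b = E p s * arrangementWeight p s a b +
      (1 - E p s) * (if b = 0 then 0 else arrangementWeight p s (a + 1) (b - 1)) := by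
  cases b with
  | zero => simp [arrangementWeight, pow_succ, mul_comm]
  | succ b =>
    simp only [arrangementWeight, Nat.multichoose_succ_succ, Nat.succ_ne_zero, if_false,
      Nat.add_sub_cancel]
    push_cast
    ring

theorem arrangementWeight_nonneg (hp : ∀ i, 1 ≤ i → 0 ≤ p i ∧ p i < 1 / 2) (s a b : ℕ) :
    0 ≤ arrangementWeight p s a b := by
  have h0 := E_nonneg hp s
  have h1 := sub_nonneg.2 (E_le_one hp s)
  unfold arrangementWeight
  positivity

theorem arrangementWeight_le_one (hp : ∀ i, 1 ≤ i → 0 ≤ p i ∧ p i < 1 / 2) (s a b : ℕ) :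
    arrangementWeight p s a b ≤ 1 := by
  have h0 := E_nonneg hp s
  have h1 := sub_nonneg.2 (E_le_one hp s)
  induction a generalizing b with
  | zero =>
    cases b with
    | zero => rw [arrangementWeight_zero_zero]
    | succ b => rw [arrangementWeight_zero_succ]; exact zero_le_one
  | succ a iha =>
    induction b with
    | zero =>
      rw [arrangementWeight_succ]
      have := iha 0
      simp only [if_true]
      nlinarith
    | succ b ihb =>
      rw [arrangementWeight_succ]
      have := iha (b + 1)
      simp only [Nat.succ_ne_zero, if_false, Nat.add_sub_cancel]
      nlinarith

theorem siteWeight_nonneg (hp : ∀ i, 1 ≤ i → 0 ≤ p i ∧ p i < 1 / 2) (s a b x : ℕ) :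
    0 ≤ siteWeight p s a b x := by
  unfold siteWeight
  split_ifs
  exacts [arrangementWeight_nonneg hp .., le_rfl, arrangementWeight_nonneg hp ..]

theorem siteWeight_le_one (hp : ∀ i, 1 ≤ i → 0 ≤ p i ∧ p i < 1 / 2) (s a b x : ℕ) :
    siteWeight p s a b x ≤ 1 := by
  unfold siteWeight
  split_ifs
  exacts [arrangementWeight_le_one hp .., zero_le_one, arrangementWeight_le_one hp ..]

theorem siteWeight_up {s x a b b' : ℕ} (hsx : s ≠ x)
    (hb : b = b' + if s = x + 1 then 1 else 0) :
    siteWeight p s a b x = siteWeight p s a b' (x + 1) := by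
  subst hb
  unfold siteWeight
  by_cases h : s = x + 1
  · subst h; simp
  · have : s ≤ x ↔ s ≤ x + 1 := by lia
    simp [h, this]

theorem siteWeight_down {s x a b : ℕ} (hs : 1 ≤ s) (hsx : s ≠ x) :
    siteWeight p s a b x = siteWeight p s a b (x - 1) := by
  have : s ≤ x ↔ s ≤ x - 1 := by lia
  simp [siteWeight, this]

theorem siteWeight_self {x a b : ℕ} (hx : 1 ≤ x) :
    siteWeight p x (a + 1) b x =
      E p x * siteWeight p x a b (x + 1) + (1 - E p x) * siteWeight p x (a + 1) b (x - 1) := by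
  have h : ¬ x ≤ x - 1 := by lia
  simp only [siteWeight, le_refl, if_true, Nat.le_succ, h, if_false]
  exact arrangementWeight_succ x a b

theorem lastWeight_up {R x w w' : ℕ} (hx : x ≤ R) (hw : w = w' + if R = x then 1 else 0) :
    lastWeight p R x w = lastWeight p R (x + 1) w' := by
  subst hw
  by_cases h : R = x
  · subst h
    simp only [lastWeight, if_true, Nat.succ_ne_zero, if_false, escape_of_le le_rfl]
    split_ifs with h
    · simp [h]
    · obtain ⟨k, rfl⟩ := Nat.exists_eq_succ_of_ne_zero h
      simp only [Nat.succ_eq_add_one, Nat.add_sub_cancel]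
      ring
  · simp [lastWeight, h, escape_of_le hx, escape_of_le (show x + 1 ≤ R by lia)]

theorem lastWeight_down {R x w : ℕ} (hx : x ≤ R) :
    lastWeight p R x w = lastWeight p R (x - 1) w := by
  simp [lastWeight, escape_of_le hx, escape_of_le (show x - 1 ≤ R by lia)]

theorem lastWeight_harmonic (hp : ∀ i, 1 ≤ i → 0 ≤ p i ∧ p i < 1 / 2) {R x w : ℕ} (hx : R < x) :
    lastWeight p R x w =
      E p x * lastWeight p R (x + 1) w + (1 - E p x) * lastWeight p R (x - 1) w := by
  have h := escape_harmonic hp hx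
  unfold lastWeight
  split_ifs
  · exact h
  · linear_combination
      (-(escape p R (R + 1) * (1 - escape p R (R + 1)) ^ (w - 1))) * h

theorem upcrossProb_step (hp : ∀ i, 1 ≤ i → 0 ≤ p i ∧ p i < 1 / 2) {m R x : ℕ} (hmR : m ≤ R)
    {w w' : ℕ → ℕ} (hw : ∀ r, m ≤ r → r ≤ R → w r = w' r + if r = x then 1 else 0) :
    upcrossProb p m R x w =
      E p x * upcrossProb p m R (x + 1) w' + (1 - E p x) * upcrossProb p m R (x - 1) w := by
  have hup : ∀ s ∈ Finset.Ioc m R, s ≠ x →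
      siteWeight p s (w s) (w (s - 1)) x = siteWeight p s (w' s) (w' (s - 1)) (x + 1) := by
    intro s hs hsx
    rw [Finset.mem_Ioc] at hs
    have h1 := hw s (by lia) hs.2
    rw [if_neg hsx, add_zero] at h1
    rw [h1]
    refine siteWeight_up hsx ?_
    rw [hw (s - 1) (by lia) (by lia)]
    congr 2
    simp only [eq_iff_iff]
    lia
  have hdown : ∀ s ∈ Finset.Ioc m R, s ≠ x →
      siteWeight p s (w s) (w (s - 1)) x = siteWeight p s (w s) (w (s - 1)) (x - 1) := by
    intro s hs hsx
    rw [Finset.mem_Ioc] at hs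
    exact siteWeight_down (by lia) hsx
  unfold upcrossProb
  by_cases hx : x ∈ Finset.Ioc m R
  · have hx' := Finset.mem_Ioc.1 hx
    rw [← Finset.mul_prod_erase _ _ hx, ← Finset.mul_prod_erase _ _ hx,
      ← Finset.mul_prod_erase _ _ hx,
      ← Finset.prod_congr rfl fun s hs => hup s (Finset.mem_of_mem_erase hs)
        (Finset.ne_of_mem_erase hs),
      ← Finset.prod_congr rfl fun s hs => hdown s (Finset.mem_of_mem_erase hs)
        (Finset.ne_of_mem_erase hs),
      ← lastWeight_up hx'.2 (hw R hmR le_rfl), ← lastWeight_down hx'.2]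
    have h1 := hw x (by lia) hx'.2
    have h2 := hw (x - 1) (by lia) (by lia)
    rw [if_pos rfl] at h1
    rw [if_neg (by lia), add_zero] at h2
    rw [h1, h2, siteWeight_self (by lia)]
    ring
  · have hne : ∀ s ∈ Finset.Ioc m R, s ≠ x := fun s hs h => hx (h ▸ hs)
    rw [← Finset.prod_congr rfl fun s hs => hup s hs (hne s hs),
      ← Finset.prod_congr rfl fun s hs => hdown s hs (hne s hs)]
    rcases le_or_gt x R with hxR | hxR
    · rw [← lastWeight_up hxR (hw R hmR le_rfl), ← lastWeight_down hxR]
      ring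
    · have h1 := hw R hmR le_rfl
      rw [if_neg (by lia), add_zero] at h1
      rw [← h1, lastWeight_harmonic hp hxR]
      ring

theorem upcrossProb_eq_zero {m R x y : ℕ} {w : ℕ → ℕ} (hm : m ≤ y) (hR : y ≤ R)
    (hy : w y = 0) (hxy : x ≤ y) : upcrossProb p m R x w = 0 := by
  unfold upcrossProb
  rcases hR.eq_or_lt with rfl | hlt
  · simp [lastWeight, hy, escape_of_le hxy]
  · have hmem : y + 1 ∈ Finset.Ioc m R := Finset.mem_Ioc.2 ⟨by lia, by lia⟩
    rw [Finset.prod_eq_zero hmem, mul_zero]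
    rw [siteWeight, if_neg (by lia), Nat.add_sub_cancel, if_pos hy]

theorem lastWeight_nonneg (hp : ∀ i, 1 ≤ i → 0 ≤ p i ∧ p i < 1 / 2) (htrans : Dinf p 0 < ⊤)
    (R x w : ℕ) : 0 ≤ lastWeight p R x w := by
  have h1 := escape_nonneg hp R x
  have h2 := sub_nonneg.2 (escape_le_one hp htrans R x)
  have h3 := escape_nonneg hp R (R + 1)
  have h4 := sub_nonneg.2 (escape_le_one hp htrans R (R + 1))
  unfold lastWeight
  split_ifs <;> positivity

theorem lastWeight_le_of_ne_zero (hp : ∀ i, 1 ≤ i → 0 ≤ p i ∧ p i < 1 / 2)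
    (htrans : Dinf p 0 < ⊤) (R x : ℕ) {w : ℕ} (hw : w ≠ 0) :
    lastWeight p R x w ≤ 1 - escape p R x := by
  have h2 := sub_nonneg.2 (escape_le_one hp htrans R x)
  have h3 := escape_nonneg hp R (R + 1)
  have h5 := escape_le_one hp htrans R (R + 1)
  have h4 := sub_nonneg.2 h5
  rw [lastWeight, if_neg hw]
  refine mul_le_of_le_one_right h2 (mul_le_one₀ h5 (pow_nonneg h4 _) (pow_le_one₀ h4 ?_))
  linarith

theorem lastWeight_le_one (hp : ∀ i, 1 ≤ i → 0 ≤ p i ∧ p i < 1 / 2) (htrans : Dinf p 0 < ⊤)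
    (R x w : ℕ) : lastWeight p R x w ≤ 1 := by
  by_cases hw : w = 0
  · rw [lastWeight, if_pos hw]
    exact escape_le_one hp htrans R x
  · linarith [lastWeight_le_of_ne_zero hp htrans R x hw, escape_nonneg hp R x]

theorem prod_siteWeight_nonneg (hp : ∀ i, 1 ≤ i → 0 ≤ p i ∧ p i < 1 / 2) (m R x : ℕ)
    (w : ℕ → ℕ) : 0 ≤ ∏ s ∈ Finset.Ioc m R, siteWeight p s (w s) (w (s - 1)) x :=
  Finset.prod_nonneg fun _ _ => siteWeight_nonneg hp ..

theorem prod_siteWeight_le_one (hp : ∀ i, 1 ≤ i → 0 ≤ p i ∧ p i < 1 / 2) (m R x : ℕ)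
    (w : ℕ → ℕ) : ∏ s ∈ Finset.Ioc m R, siteWeight p s (w s) (w (s - 1)) x ≤ 1 :=
  Finset.prod_le_one (fun _ _ => siteWeight_nonneg hp ..) fun _ _ => siteWeight_le_one hp ..

theorem upcrossProb_nonneg (hp : ∀ i, 1 ≤ i → 0 ≤ p i ∧ p i < 1 / 2) (htrans : Dinf p 0 < ⊤)
    (m R x : ℕ) (w : ℕ → ℕ) : 0 ≤ upcrossProb p m R x w :=
  mul_nonneg (lastWeight_nonneg hp htrans ..) (prod_siteWeight_nonneg hp ..)

theorem upcrossProb_le_one (hp : ∀ i, 1 ≤ i → 0 ≤ p i ∧ p i < 1 / 2) (htrans : Dinf p 0 < ⊤)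
    (m R x : ℕ) (w : ℕ → ℕ) : upcrossProb p m R x w ≤ 1 :=
  mul_le_one₀ (lastWeight_le_one hp htrans ..) (prod_siteWeight_nonneg hp ..)
    (prod_siteWeight_le_one hp ..)

theorem escape_le_upcrossProb (hp : ∀ i, 1 ≤ i → 0 ≤ p i ∧ p i < 1 / 2) (htrans : Dinf p 0 < ⊤)
    {m R : ℕ} (hmR : m ≤ R) (x : ℕ) {w : ℕ → ℕ} (hw : ∀ r, m ≤ r → r ≤ R → w r = 0) :
    escape p R x ≤ upcrossProb p m R x w := by
  rcases le_or_gt x R with hx | hx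
  · rw [escape_of_le hx]
    exact upcrossProb_nonneg hp htrans ..
  · rw [upcrossProb, Finset.prod_eq_one, mul_one, lastWeight, if_pos (hw R hmR le_rfl)]
    intro s hs
    rw [Finset.mem_Ioc] at hs
    rw [hw s (by lia) hs.2, hw (s - 1) (by lia) (by lia), siteWeight, if_pos (by lia),
      arrangementWeight_zero_zero]

theorem upcrossProb_le (hp : ∀ i, 1 ≤ i → 0 ≤ p i ∧ p i < 1 / 2) (htrans : Dinf p 0 < ⊤)
    {m R : ℕ} (x : ℕ) {w : ℕ → ℕ} (hw : ¬ ∀ r, m ≤ r → r ≤ R → w r = 0) :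
    upcrossProb p m R x w ≤ 1 - escape p R x := by
  have h1 := sub_nonneg.2 (escape_le_one hp htrans R x)
  rcases le_or_gt x R with hx | hx
  · rw [escape_of_le hx, sub_zero]
    exact upcrossProb_le_one hp htrans ..
  by_cases hR : w R = 0
  · obtain ⟨s, hs, h0, hne⟩ : ∃ s ∈ Finset.Ioc m R, w s = 0 ∧ w (s - 1) ≠ 0 := by
      by_contra! hcon
      refine hw fun r hm hr => ?_
      induction hr using Nat.decreasingInduction with
      | self => exact hR
      | of_succ k hk ih =>
        exact hcon (k + 1) (Finset.mem_Ioc.2 ⟨by lia, hk⟩) (ih (by lia))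
    rw [upcrossProb, Finset.prod_eq_zero hs, mul_zero]
    · exact h1
    · obtain ⟨b, hb⟩ := Nat.exists_eq_succ_of_ne_zero hne
      rw [h0, hb, siteWeight, if_pos (by have := (Finset.mem_Ioc.1 hs).2; lia),
        Nat.succ_eq_add_one, arrangementWeight_zero_succ]
  · calc upcrossProb p m R x w ≤ (1 - escape p R x) * 1 :=
        mul_le_mul (lastWeight_le_of_ne_zero hp htrans R x hR) (prod_siteWeight_le_one hp ..)
          (prod_siteWeight_nonneg hp ..) h1
      _ = 1 - escape p R x := mul_one _

end Harmonic

/-! ### Histories of the walk -/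

instance : MeasurableSpace (List ℕ) := ⊤

instance : DiscreteMeasurableSpace (List ℕ) := ⟨fun _ => trivial⟩

/-- The trajectory of `X` up to time `n`, most recent position first. -/
def history {Ω : Type*} (X : ℕ → Ω → ℕ) : ℕ → Ω → List ℕ
  | 0, ω => [X 0 ω]
  | n + 1, ω => X (n + 1) ω :: history X n ω

/-- The number of upcrossings at `r` in a history. -/
def upcount (r : ℕ) : List ℕ → ℕ
  | [] => 0
  | y :: l => upcount r l + if l.headI = r ∧ y = r + 1 then 1 else 0

section History

variable {Ω : Type*} {X : ℕ → Ω → ℕ}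

theorem headI_history (n : ℕ) (ω : Ω) : (history X n ω).headI = X n ω := by
  cases n <;> rfl

theorem history_eq_iff {n : ℕ} {ω ω' : Ω} :
    history X n ω = history X n ω' ↔ ∀ k ≤ n, X k ω = X k ω' := by
  induction n with
  | zero => simp [history]
  | succ n ih =>
    simp only [history, List.cons.injEq, ih]
    constructor
    · rintro ⟨h1, h2⟩ k hk
      rcases Nat.le_succ_iff.1 hk with hk | rfl
      exacts [h2 k hk, h1]
    · exact fun h => ⟨h _ le_rfl, fun k hk => h k (by lia)⟩

theorem upcount_history (h0 : ∀ ω, X 0 ω = 0) (r n : ℕ) (ω : Ω) :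
    (upcount r (history X n ω) : ℝ≥0∞) =
      ∑ k ∈ Finset.range n,
        Set.indicator {k | X k ω = r ∧ X (k + 1) ω = r + 1} (fun _ => (1 : ℝ≥0∞)) k := by
  induction n with
  | zero => simp [history, upcount, h0]
  | succ n ih =>
    rw [Finset.sum_range_succ, ← ih, history, upcount, headI_history, Set.indicator_apply]
    push_cast
    rfl

theorem tendsto_upcount (h0 : ∀ ω, X 0 ω = 0) (r : ℕ) (ω : Ω) :
    Tendsto (fun n => (upcount r (history X n ω) : ℝ≥0∞)) atTop (𝓝 (upcross X r ω)) := by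
  simp_rw [upcount_history h0]
  exact ENNReal.tendsto_nat_tsum _

theorem eventually_upcount_iff (h0 : ∀ ω, X 0 ω = 0) (r v : ℕ) (ω : Ω) :
    ∀ᶠ n in atTop, upcount r (history X n ω) = v ↔ upcross X r ω = v := by
  have ht := tendsto_upcount h0 r ω
  by_cases h : upcross X r ω = v
  · have h1 : Tendsto (fun n => (upcount r (history X n ω) : ℝ≥0∞) + 1) atTop (𝓝 (v + 1)) := by
      rw [← h]
      exact ht.add_const 1
    have h2 : (v : ℝ≥0∞) < v + 1 := ENNReal.lt_add_right (ENNReal.natCast_ne_top v) one_ne_zero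
    filter_upwards [h1.eventually_const_lt h2] with n hn
    have hle : (upcount r (history X n ω) : ℝ≥0∞) ≤ v := by
      rw [← h, upcount_history h0]
      exact ENNReal.sum_le_tsum _
    have hn' : v < upcount r (history X n ω) + 1 := by exact_mod_cast hn
    have hle' : upcount r (history X n ω) ≤ v := by exact_mod_cast hle
    simp only [h, iff_true]
    lia
  · filter_upwards [ht.eventually_ne h] with n hn
    simp only [h, iff_false]
    exact fun hh => hn (by rw [hh])

end History

section Walk

variable {Ω : Type*} [MeasurableSpace Ω] {P : Measure Ω} {X : ℕ → Ω → ℕ} {p : ℕ → ℝ}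

theorem step_nonneg (hp : ∀ i, 1 ≤ i → 0 ≤ p i ∧ p i < 1 / 2) (i j : ℕ) : 0 ≤ step p i j := by
  unfold step
  split_ifs
  exacts [E_nonneg hp i, sub_nonneg.2 (E_le_one hp i), le_rfl]

theorem step_pred (i : ℕ) : step p i (i - 1) = 1 - E p i := by
  cases i with
  | zero => simp [step, E]
  | succ i => rw [step, if_neg (by lia), if_pos (by lia)]

theorem tsum_step (i : ℕ) (f : ℕ → ℝ≥0∞) :
    ∑' y, ENNReal.ofReal (step p i y) * f y =
      ENNReal.ofReal (E p i) * f (i + 1) + ENNReal.ofReal (1 - E p i) * f (i - 1) := by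
  have hne : i + 1 ≠ i - 1 := by lia
  rw [tsum_eq_sum (s := {i + 1, i - 1}), Finset.sum_pair hne, step_pred]
  · simp [step]
  · intro y hy
    simp only [Finset.mem_insert, Finset.mem_singleton, not_or] at hy
    rw [step, if_neg hy.1, if_neg (by lia), ENNReal.ofReal_zero, zero_mul]

theorem measure_history_cons (hp : ∀ i, 1 ≤ i → 0 ≤ p i ∧ p i < 1 / 2) (hX : IsNNWalk P X p 0)
    (n y : ℕ) (l : List ℕ) :
    P {ω | X (n + 1) ω = y ∧ history X n ω = l} =
      P {ω | history X n ω = l} * ENNReal.ofReal (step p l.headI y) := by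
  by_cases hl : ∃ ω₀, history X n ω₀ = l
  · obtain ⟨ω₀, rfl⟩ := hl
    set u : ℕ → ℕ := fun k => if k ≤ n then X k ω₀ else y with hu
    have hu0 : u 0 = 0 := by simp [hu, hX.1]
    have e1 : {ω | history X n ω = history X n ω₀} = {ω | ∀ k ≤ n, X k ω = u k} := by
      ext ω
      simp only [Set.mem_ofPred_eq, history_eq_iff]
      exact forall₂_congr fun k hk => by simp [hu, hk]
    have e2 : {ω | X (n + 1) ω = y ∧ history X n ω = history X n ω₀} =
        {ω | ∀ k ≤ n + 1, X k ω = u k} := by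
      ext ω
      simp only [Set.mem_ofPred_eq, history_eq_iff]
      constructor
      · rintro ⟨h1, h2⟩ k hk
        rcases Nat.le_succ_iff.1 hk with hk | rfl
        · simp [hu, hk, h2 k hk]
        · simp [hu, h1]
      · intro h
        refine ⟨by simpa [hu] using h (n + 1) le_rfl, fun k hk => ?_⟩
        simpa [hu, hk] using h k (by lia)
    rw [e1, e2, hX.2 _ u hu0, hX.2 _ u hu0, Finset.prod_range_succ,
      ENNReal.ofReal_mul (Finset.prod_nonneg fun _ _ => step_nonneg hp ..), headI_history]
    simp [hu]
  · have e1 : {ω | history X n ω = l} = ∅ := by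
      ext ω; simpa using fun h => hl ⟨ω, h⟩
    have e2 : {ω | X (n + 1) ω = y ∧ history X n ω = l} = ∅ := by
      ext ω; simpa using fun _ h => hl ⟨ω, h⟩
    simp [e1, e2]

/-- A subset `B` of a null-measurable set `A` of finite measure is null-measurable if the
outer measures of `B` and `A \ B` add up to that of `A`. -/
theorem nullMeasurableSet_of_add_sdiff_le {A B : Set Ω} (hA : NullMeasurableSet A P)
    (hfin : P A ≠ ⊤) (hBA : B ⊆ A) (h : P B + P (A \ B) ≤ P A) : NullMeasurableSet B P := by
  set B' := toMeasurable P B ∩ A with hB'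
  set C' := toMeasurable P (A \ B) ∩ A with hC'
  have hB'm : NullMeasurableSet B' P := (measurableSet_toMeasurable _ _).nullMeasurableSet.inter hA
  have hC'm : NullMeasurableSet C' P := (measurableSet_toMeasurable _ _).nullMeasurableSet.inter hA
  have hBB' : B ⊆ B' := Set.subset_inter (subset_toMeasurable _ _) hBA
  have hCC' : A \ B ⊆ C' := Set.subset_inter (subset_toMeasurable _ _) Set.sdiff_subset
  have hPB : P B' ≤ P B := (measure_mono Set.inter_subset_left).trans_eq (measure_toMeasurable _)
  have hPC : P C' ≤ P (A \ B) :=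
    (measure_mono Set.inter_subset_left).trans_eq (measure_toMeasurable _)
  have hA' : P A ≤ P (B' ∪ C') := measure_mono fun ω hω => by
    by_cases hωB : ω ∈ B
    exacts [Or.inl (hBB' hωB), Or.inr (hCC' ⟨hω, hωB⟩)]
  have hsum := measure_union_add_inter₀ (μ := P) B' hC'm
  have hle : P A + P (B' ∩ C') ≤ P A + 0 := by
    rw [add_zero]
    calc P A + P (B' ∩ C') ≤ P (B' ∪ C') + P (B' ∩ C') := by gcongr
      _ = P B' + P C' := hsum
      _ ≤ P B + P (A \ B) := by gcongr
      _ ≤ P A := h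
  have h0 : P (B' ∩ C') = 0 := by
    simpa using (ENNReal.add_le_add_iff_left hfin).1 hle
  have hd : P (B' \ B) = 0 := measure_mono_null (fun ω hω => by
    exact ⟨hω.1, hCC' ⟨hω.1.2, hω.2⟩⟩) h0
  have hB : B = B' \ (B' \ B) := by
    rw [Set.sdiff_sdiff_cancel_left hBB']
  rw [hB]
  exact hB'm.diff (NullMeasurableSet.of_null hd)

theorem aemeasurable_of_countable {β : Type*} [Countable β] [MeasurableSpace β]
    [DiscreteMeasurableSpace β] {f : Ω → β} (h : ∀ b, NullMeasurableSet {ω | f ω = b} P) :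
    AEMeasurable f P := by
  refine NullMeasurable.aemeasurable fun s _ => ?_
  have : f ⁻¹' s = ⋃ b ∈ s, {ω | f ω = b} := by ext ω; simp
  rw [this]
  exact NullMeasurableSet.biUnion s.to_countable fun b _ => h b

theorem lintegral_comp_countable {β : Type*} [Countable β] [MeasurableSpace β]
    [DiscreteMeasurableSpace β] {f : Ω → β} (hf : AEMeasurable f P) (F : β → ℝ≥0∞) :
    ∫⁻ ω, F (f ω) ∂P = ∑' b, F b * P {ω | f ω = b} := by
  rw [← lintegral_map' (Measurable.of_discrete).aemeasurable hf, lintegral_countable']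
  refine tsum_congr fun b => ?_
  rw [Measure.map_apply_of_aemeasurable hf (measurableSet_singleton b)]
  rfl

variable [IsProbabilityMeasure P]

theorem nullMeasurableSet_history (hp : ∀ i, 1 ≤ i → 0 ≤ p i ∧ p i < 1 / 2)
    (hX : IsNNWalk P X p 0) (n : ℕ) :
    (∀ l, NullMeasurableSet {ω | history X n ω = l} P) ∧
      ∀ y l, NullMeasurableSet {ω | X (n + 1) ω = y ∧ history X n ω = l} P := by
  have key : ∀ n, (∀ l, NullMeasurableSet {ω | history X n ω = l} P) →
      ∀ y l, NullMeasurableSet {ω | X (n + 1) ω = y ∧ history X n ω = l} P := by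
    intro n ih y l
    refine nullMeasurableSet_of_add_sdiff_le (ih l) (measure_ne_top _ _) (fun ω h => h.2) ?_
    have hsum : ∑' z, P {ω | X (n + 1) ω = z ∧ history X n ω = l} =
        P {ω | history X n ω = l} := by
      simp_rw [measure_history_cons hp hX, ENNReal.tsum_mul_left]
      have := tsum_step (p := p) l.headI fun _ => 1
      simp only [mul_one] at this
      rw [this, ← ENNReal.ofReal_add (E_nonneg hp _) (sub_nonneg.2 (E_le_one hp _))]
      simp
    rw [← hsum, ENNReal.tsum_eq_add_tsum_ite y]
    gcongr
    refine (measure_mono (t := ⋃ z, if z = y then ∅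
      else {ω | X (n + 1) ω = z ∧ history X n ω = l}) fun ω hω => ?_).trans
      ((measure_iUnion_le _).trans_eq (tsum_congr fun z => ?_))
    · obtain ⟨h1, h2⟩ := hω
      simp only [Set.mem_ofPred_eq, not_and] at h1 h2
      refine Set.mem_iUnion.2 ⟨X (n + 1) ω, ?_⟩
      rw [if_neg fun h => h2 h h1]
      exact ⟨rfl, h1⟩
    · split_ifs <;> simp
  have hall : ∀ n l, NullMeasurableSet {ω | history X n ω = l} P := by
    intro n
    induction n with
    | zero => simp [history, hX.1]
    | succ n ih =>
      intro l
      cases l with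
      | nil => simp [history]
      | cons y l => simpa [history] using key n ih y l
  exact ⟨hall n, key n (hall n)⟩

theorem aemeasurable_history (hp : ∀ i, 1 ≤ i → 0 ≤ p i ∧ p i < 1 / 2)
    (hX : IsNNWalk P X p 0) (n : ℕ) : AEMeasurable (history X n) P :=
  aemeasurable_of_countable (nullMeasurableSet_history hp hX n).1

theorem lintegral_history_succ (hp : ∀ i, 1 ≤ i → 0 ≤ p i ∧ p i < 1 / 2)
    (hX : IsNNWalk P X p 0) (n : ℕ) (F : List ℕ → ℝ≥0∞) :
    ∫⁻ ω, F (history X (n + 1) ω) ∂P =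
      ∫⁻ ω, (ENNReal.ofReal (E p (X n ω)) * F ((X n ω + 1) :: history X n ω) +
        ENNReal.ofReal (1 - E p (X n ω)) * F ((X n ω - 1) :: history X n ω)) ∂P := by
  have hpair : AEMeasurable (fun ω => (history X n ω, X (n + 1) ω)) P := by
    refine aemeasurable_of_countable fun b => ?_
    simpa [Prod.ext_iff, and_comm] using (nullMeasurableSet_history hp hX n).2 b.2 b.1
  have h1 := lintegral_comp_countable hpair fun b => F (b.2 :: b.1)
  have h2 := lintegral_comp_countable (aemeasurable_history hp hX n) fun l =>
    ENNReal.ofReal (E p l.headI) * F ((l.headI + 1) :: l) +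
      ENNReal.ofReal (1 - E p l.headI) * F ((l.headI - 1) :: l)
  simp only [headI_history] at h2
  rw [h2]
  refine h1.trans ?_
  rw [ENNReal.tsum_prod']
  refine tsum_congr fun l => ?_
  rw [← tsum_step l.headI fun y => F (y :: l), ← ENNReal.tsum_mul_right]
  refine tsum_congr fun y => ?_
  have := measure_history_cons hp hX n y l
  simp only [Prod.mk.injEq, and_comm (a := history X n _ = l), this]
  ring

/-! ### Transience -/

theorem lintegral_escape_succ (hp : ∀ i, 1 ≤ i → 0 ≤ p i ∧ p i < 1 / 2)
    (hX : IsNNWalk P X p 0) (n : ℕ) :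
    ∫⁻ ω, ENNReal.ofReal (escape p 0 (X (n + 1) ω)) ∂P =
      ∫⁻ ω, ENNReal.ofReal (escape p 0 (X n ω)) ∂P +
        ENNReal.ofReal (escape p 0 1) * P {ω | X n ω = 0} := by
  have hset : {ω | X n ω = 0} = history X n ⁻¹' {l | l.headI = 0} := by
    ext ω; simp [headI_history]
  have hnull : NullMeasurableSet {ω | X n ω = 0} P := by
    rw [hset]
    exact (aemeasurable_history hp hX n).nullMeasurable (MeasurableSet.of_discrete)
  have h := lintegral_history_succ hp hX n fun l => ENNReal.ofReal (escape p 0 l.headI)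
  simp only [headI_history, List.headI_cons] at h
  have hind : AEMeasurable ({ω | X n ω = 0}.indicator (1 : Ω → ℝ≥0∞)) P :=
    (aemeasurable_indicator_const_iff 1).2 hnull
  rw [h, ← lintegral_indicator_one₀ hnull, ← lintegral_const_mul'' _ hind, ← lintegral_add_left']
  · refine lintegral_congr fun ω => ?_
    rcases Nat.eq_zero_or_pos (X n ω) with h0 | h0
    · simp [h0, escape_of_le, E]
    · rw [Set.indicator_of_notMem (by simpa using h0.ne'), mul_zero, add_zero,
        escape_harmonic hp h0, ENNReal.ofReal_add, ENNReal.ofReal_mul (E_nonneg hp _),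
        ENNReal.ofReal_mul (sub_nonneg.2 (E_le_one hp _))]
      · exact mul_nonneg (E_nonneg hp _) (escape_nonneg hp ..)
      · exact mul_nonneg (sub_nonneg.2 (E_le_one hp _)) (escape_nonneg hp ..)
  · have : (fun ω => ENNReal.ofReal (escape p 0 (X n ω))) =
        (fun l : List ℕ => ENNReal.ofReal (escape p 0 l.headI)) ∘ history X n := by
      ext ω; simp [headI_history]
    rw [this]
    exact Measurable.of_discrete.comp_aemeasurable (aemeasurable_history hp hX n)

theorem tendsto_measure_eq (hp : ∀ i, 1 ≤ i → 0 ≤ p i ∧ p i < 1 / 2) (htrans : Dinf p 0 < ⊤)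
    (hX : IsNNWalk P X p 0) (x : ℕ) : Tendsto (fun n => P {ω | X n ω = x}) atTop (𝓝 0) := by
  induction x with
  | zero =>
    have hq : 0 < escape p 0 1 := by
      rw [escape_succ_self]
      exact one_div_pos.2 (tsum_ratioProd_pos hp htrans 0)
    have hle : ∀ n, ∑ k ∈ Finset.range n, ENNReal.ofReal (escape p 0 1) * P {ω | X k ω = 0} ≤
        ∫⁻ ω, ENNReal.ofReal (escape p 0 (X n ω)) ∂P := by
      intro n
      induction n with
      | zero => simp
      | succ n ih =>
        rw [Finset.sum_range_succ, lintegral_escape_succ hp hX]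
        gcongr
    have hle1 : ∀ n, ∫⁻ ω, ENNReal.ofReal (escape p 0 (X n ω)) ∂P ≤ 1 := fun n => by
      calc ∫⁻ ω, ENNReal.ofReal (escape p 0 (X n ω)) ∂P ≤ ∫⁻ _, 1 ∂P :=
            lintegral_mono fun ω => ENNReal.ofReal_le_one.2 (escape_le_one hp htrans ..)
        _ = 1 := by simp
    have hsum : ∑' k, ENNReal.ofReal (escape p 0 1) * P {ω | X k ω = 0} ≠ ⊤ :=
      ((ENNReal.summable.tsum_le_of_sum_range_le fun n => (hle n).trans (hle1 n)).trans_lt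
        ENNReal.one_lt_top).ne
    rw [ENNReal.tsum_mul_left] at hsum
    refine ENNReal.tendsto_atTop_zero_of_tsum_ne_top fun htop => hsum ?_
    rw [htop, ENNReal.mul_top (ENNReal.ofReal_pos.2 hq).ne']
  | succ x ih =>
    have hd : ENNReal.ofReal (1 - E p (x + 1)) ≠ 0 :=
      (ENNReal.ofReal_pos.2 (sub_pos.2 (E_succ_lt_one hp x))).ne'
    have hind : ∀ n y, ∫⁻ ω, (if (history X n ω).headI = y then 1 else 0) ∂P =
        P {ω | X n ω = y} := by
      intro n y
      have hset : {ω | X n ω = y} = history X n ⁻¹' {l | l.headI = y} := by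
        ext ω; simp [headI_history]
      have hnull : NullMeasurableSet {ω | X n ω = y} P := by
        rw [hset]
        exact (aemeasurable_history hp hX n).nullMeasurable (MeasurableSet.of_discrete)
      rw [← lintegral_indicator_one₀ hnull]
      simp [Set.indicator_apply, headI_history]
    have hle : ∀ n, ENNReal.ofReal (1 - E p (x + 1)) * P {ω | X n ω = x + 1} ≤
        P {ω | X (n + 1) ω = x} := by
      intro n
      have h := lintegral_history_succ hp hX n fun l => if l.headI = x then 1 else 0
      simp only [List.headI_cons] at h
      rw [← hind (n + 1) x, h, ← hind n (x + 1), ← lintegral_const_mul' _ _ ENNReal.ofReal_ne_top]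
      refine lintegral_mono fun ω => ?_
      simp only [headI_history]
      split_ifs <;> simp_all
    have h2 : Tendsto (fun n => (ENNReal.ofReal (1 - E p (x + 1)))⁻¹ * P {ω | X (n + 1) ω = x})
        atTop (𝓝 0) := by
      have := ENNReal.Tendsto.const_mul (a := (ENNReal.ofReal (1 - E p (x + 1)))⁻¹)
        (ih.comp (tendsto_add_atTop_nat 1)) (Or.inr (ENNReal.inv_ne_top.2 hd))
      simpa using this
    refine tendsto_of_tendsto_of_tendsto_of_le_of_le tendsto_const_nhds h2
      (fun _ => zero_le) fun n => ?_
    have := mul_le_mul_right (hle n) (ENNReal.ofReal (1 - E p (x + 1)))⁻¹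
    rwa [← mul_assoc, ENNReal.inv_mul_cancel hd ENNReal.ofReal_ne_top, one_mul] at this

theorem tendsto_lintegral_one_sub_escape (hp : ∀ i, 1 ≤ i → 0 ≤ p i ∧ p i < 1 / 2)
    (htrans : Dinf p 0 < ⊤) (hX : IsNNWalk P X p 0) (R : ℕ) :
    Tendsto (fun n => ∫⁻ ω, ENNReal.ofReal (1 - escape p R (X n ω)) ∂P) atTop (𝓝 0) := by
  refine ENNReal.tendsto_nhds_zero.2 fun ε hε => ?_
  have hlim : Tendsto (fun x => ENNReal.ofReal (1 - escape p R x)) atTop (𝓝 0) := by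
    have := ENNReal.tendsto_ofReal ((tendsto_escape hp htrans R).const_sub 1)
    simpa using this
  obtain ⟨M, hM⟩ := eventually_atTop.1 (ENNReal.tendsto_nhds_zero.1 hlim _ (ENNReal.half_pos hε.ne'))
  have hsum : Tendsto (fun n => ∑ x ∈ Finset.range M, P {ω | X n ω = x}) atTop (𝓝 0) := by
    simpa using tendsto_finsetSum (Finset.range M) fun x _ => tendsto_measure_eq hp htrans hX x
  filter_upwards [ENNReal.tendsto_nhds_zero.1 hsum _ (ENNReal.half_pos hε.ne')] with n hn
  have hmeas : MeasurableSet {l : List ℕ | l.headI < M} := MeasurableSet.of_discrete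
  have hset : {ω | X n ω < M} = history X n ⁻¹' {l | l.headI < M} := by
    ext ω; simp [headI_history]
  have hnull : NullMeasurableSet {ω | X n ω < M} P := by
    rw [hset]
    exact (aemeasurable_history hp hX n).nullMeasurable hmeas
  calc ∫⁻ ω, ENNReal.ofReal (1 - escape p R (X n ω)) ∂P
      ≤ ∫⁻ ω, (ε / 2 + {ω | X n ω < M}.indicator 1 ω) ∂P := lintegral_mono fun ω => by
        by_cases h : X n ω < M
        · rw [Set.indicator_of_mem (by exact h)]
          refine le_add_left (ENNReal.ofReal_le_one.2 ?_)
          linarith [escape_nonneg hp R (X n ω)]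
        · exact le_add_right (hM _ (not_lt.1 h))
    _ = ε / 2 + P {ω | X n ω < M} := by
        rw [lintegral_add_left measurable_const, lintegral_indicator_one₀ hnull]
        simp
    _ ≤ ε / 2 + ε / 2 := by
        gcongr
        refine le_trans ?_ hn
        refine (measure_mono fun ω (hω : X n ω < M) => ?_).trans
          (measure_biUnion_finset_le (Finset.range M) fun x => {ω | X n ω = x})
        simpa using hω
    _ = ε := ENNReal.add_halves ε

/-! ### The joint law of the numbers of upcrossings -/

open Classical in
/-- The probability, given a history, that the total number of upcrossings will be `v r` at each
`r ∈ [m, R]`. -/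
def totalUpcrossProb (p : ℕ → ℝ) (m R : ℕ) (v : ℕ → ℕ) (l : List ℕ) : ℝ :=
  if ∀ r, m ≤ r → r ≤ R → upcount r l ≤ v r then
    upcrossProb p m R l.headI fun r => v r - upcount r l
  else 0

theorem totalUpcrossProb_nonneg (hp : ∀ i, 1 ≤ i → 0 ≤ p i ∧ p i < 1 / 2)
    (htrans : Dinf p 0 < ⊤) (m R : ℕ) (v : ℕ → ℕ) (l : List ℕ) :
    0 ≤ totalUpcrossProb p m R v l := by
  unfold totalUpcrossProb
  split_ifs
  exacts [upcrossProb_nonneg hp htrans .., le_rfl]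

theorem totalUpcrossProb_step (hp : ∀ i, 1 ≤ i → 0 ≤ p i ∧ p i < 1 / 2) {m R : ℕ} (hmR : m ≤ R)
    (v : ℕ → ℕ) (l : List ℕ) :
    totalUpcrossProb p m R v l =
      E p l.headI * totalUpcrossProb p m R v ((l.headI + 1) :: l) +
        (1 - E p l.headI) * totalUpcrossProb p m R v ((l.headI - 1) :: l) := by
  have hup : ∀ r, upcount r ((l.headI + 1) :: l) = upcount r l + if r = l.headI then 1 else 0 := by
    intro r
    simp only [upcount]
    congr 2
    simp only [eq_iff_iff]
    lia
  have hdown : ∀ r, upcount r ((l.headI - 1) :: l) = upcount r l := by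
    intro r
    simp only [upcount]
    rw [if_neg (by lia), add_zero]
  simp only [totalUpcrossProb, hup, hdown, List.headI_cons]
  by_cases halive : ∀ r, m ≤ r → r ≤ R → upcount r l ≤ v r
  · rw [if_pos halive, if_pos halive]
    by_cases hnext : ∀ r, m ≤ r → r ≤ R → (upcount r l + if r = l.headI then 1 else 0) ≤ v r
    · rw [if_pos hnext]
      refine upcrossProb_step hp hmR fun r h1 h2 => ?_
      have := hnext r h1 h2
      lia
    · rw [if_neg hnext]
      push Not at hnext
      obtain ⟨r, h1, h2, h3⟩ := hnext
      have h4 := halive r h1 h2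
      have hr : r = l.headI := by
        by_contra hne
        rw [if_neg hne] at h3
        lia
      rw [if_pos hr] at h3
      have h5 : v r - upcount r l = 0 := by lia
      rw [upcrossProb_eq_zero h1 h2 h5 hr.ge, upcrossProb_eq_zero h1 h2 h5 (by lia)]
      simp
  · rw [if_neg halive, if_neg fun h => halive fun r h1 h2 => (Nat.le_add_right _ _).trans (h r h1 h2)]
    simp [halive]

theorem lintegral_totalUpcrossProb (hp : ∀ i, 1 ≤ i → 0 ≤ p i ∧ p i < 1 / 2)
    (htrans : Dinf p 0 < ⊤) (hX : IsNNWalk P X p 0) {m R : ℕ} (hmR : m ≤ R) (v : ℕ → ℕ) (n : ℕ) :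
    ∫⁻ ω, ENNReal.ofReal (totalUpcrossProb p m R v (history X n ω)) ∂P =
      ENNReal.ofReal (upcrossProb p m R 0 v) := by
  induction n with
  | zero => simp [history, hX.1, totalUpcrossProb, upcount]
  | succ n ih =>
    rw [← ih, lintegral_history_succ hp hX n fun l => ENNReal.ofReal (totalUpcrossProb p m R v l)]
    refine lintegral_congr fun ω => ?_
    have h0 := E_nonneg hp (X n ω)
    have h1 := sub_nonneg.2 (E_le_one hp (X n ω))
    rw [totalUpcrossProb_step hp hmR v (history X n ω), headI_history, ENNReal.ofReal_add
      (mul_nonneg h0 (totalUpcrossProb_nonneg hp htrans ..))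
      (mul_nonneg h1 (totalUpcrossProb_nonneg hp htrans ..)),
      ENNReal.ofReal_mul h0, ENNReal.ofReal_mul h1]

theorem totalUpcrossProb_le (hp : ∀ i, 1 ≤ i → 0 ≤ p i ∧ p i < 1 / 2) (htrans : Dinf p 0 < ⊤)
    (m R : ℕ) (v : ℕ → ℕ) {l : List ℕ} (hl : ¬ ∀ r, m ≤ r → r ≤ R → upcount r l = v r) :
    totalUpcrossProb p m R v l ≤ 1 - escape p R l.headI := by
  unfold totalUpcrossProb
  split_ifs with h
  · refine upcrossProb_le hp htrans _ fun h0 => hl fun r h1 h2 => ?_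
    have := h r h1 h2
    have := h0 r h1 h2
    lia
  · exact sub_nonneg.2 (escape_le_one hp htrans ..)

theorem totalUpcrossProb_le_one (hp : ∀ i, 1 ≤ i → 0 ≤ p i ∧ p i < 1 / 2)
    (htrans : Dinf p 0 < ⊤) (m R : ℕ) (v : ℕ → ℕ) (l : List ℕ) :
    totalUpcrossProb p m R v l ≤ 1 := by
  unfold totalUpcrossProb
  split_ifs
  exacts [upcrossProb_le_one hp htrans .., zero_le_one]

theorem escape_le_totalUpcrossProb (hp : ∀ i, 1 ≤ i → 0 ≤ p i ∧ p i < 1 / 2)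
    (htrans : Dinf p 0 < ⊤) {m R : ℕ} (hmR : m ≤ R) (v : ℕ → ℕ) {l : List ℕ}
    (hl : ∀ r, m ≤ r → r ≤ R → upcount r l = v r) :
    escape p R l.headI ≤ totalUpcrossProb p m R v l := by
  rw [totalUpcrossProb, if_pos fun r h1 h2 => (hl r h1 h2).le]
  exact escape_le_upcrossProb hp htrans hmR _ fun r h1 h2 => by rw [hl r h1 h2, Nat.sub_self]

theorem measure_upcross_eq (hp : ∀ i, 1 ≤ i → 0 ≤ p i ∧ p i < 1 / 2) (htrans : Dinf p 0 < ⊤)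
    (hX : IsNNWalk P X p 0) {m R : ℕ} (hmR : m ≤ R) (v : ℕ → ℕ) :
    P {ω | ∀ r, m ≤ r → r ≤ R → upcross X r ω = (v r : ℝ≥0∞)} =
      ENNReal.ofReal (upcrossProb p m R 0 v) := by
  set A : Set Ω := {ω | ∀ r, m ≤ r → r ≤ R → upcross X r ω = (v r : ℝ≥0∞)} with hA
  set B : Set (List ℕ) := {l | ∀ r, m ≤ r → r ≤ R → upcount r l = v r} with hB
  have hBm : ∀ n, NullMeasurableSet (history X n ⁻¹' B) P := fun n =>
    (aemeasurable_history hp hX n).nullMeasurable MeasurableSet.of_discrete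
  have hev : ∀ ω, ∀ᶠ n in atTop, ω ∈ history X n ⁻¹' B ↔ ω ∈ A := by
    intro ω
    have := (Filter.eventually_all_finset (Finset.Icc m R)).2
      fun r _ => eventually_upcount_iff hX.1 r (v r) ω
    filter_upwards [this] with n hn
    simp only [hA, hB, Set.mem_preimage, Set.mem_ofPred_eq]
    exact forall_congr' fun r => forall₂_congr fun h1 h2 => hn r (Finset.mem_Icc.2 ⟨h1, h2⟩)
  have hAm : NullMeasurableSet A P :=
    nullMeasurableSet_of_tendsto_indicator atTop hBm (ae_of_all _ hev)
  have hBi : ∀ n, AEMeasurable ((history X n ⁻¹' B).indicator (1 : Ω → ℝ≥0∞)) P := fun n =>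
    (aemeasurable_indicator_const_iff 1).2 (hBm n)
  have hlim : Tendsto (fun n => P (history X n ⁻¹' B)) atTop (𝓝 (P A)) := by
    simp_rw [← lintegral_indicator_one₀ hAm, ← lintegral_indicator_one₀ (hBm _)]
    refine tendsto_lintegral_of_dominated_convergence' (fun _ : Ω => (1 : ℝ≥0∞)) hBi ?_
      (by simp) ?_
    · exact fun n => ae_of_all _ fun ω => Set.indicator_le_self _ _ ω
    · exact ae_of_all _ fun ω =>
        (tendsto_indicator_const_apply_iff_eventually atTop (1 : ℝ≥0∞) ω).2 (hev ω)
  have hesc := tendsto_lintegral_one_sub_escape hp htrans hX R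
  have hV := lintegral_totalUpcrossProb hp htrans hX hmR v
  have hem : ∀ n (F : List ℕ → ℝ≥0∞), AEMeasurable (fun ω => F (history X n ω)) P :=
    fun n F => Measurable.of_discrete.comp_aemeasurable (aemeasurable_history hp hX n)
  refine le_antisymm ?_ ?_
  · refine le_of_tendsto_of_tendsto' hlim
      (g := fun n => ENNReal.ofReal (upcrossProb p m R 0 v) +
        ∫⁻ ω, ENNReal.ofReal (1 - escape p R (X n ω)) ∂P) ?_ fun n => ?_
    · simpa using hesc.const_add (ENNReal.ofReal (upcrossProb p m R 0 v))
    · rw [← hV n, ← lintegral_add_left'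
        (hem n fun l => ENNReal.ofReal (totalUpcrossProb p m R v l)), ← lintegral_indicator_one₀ (hBm n)]
      refine lintegral_mono (Set.indicator_le fun ω hω => ?_)
      rw [← ENNReal.ofReal_add (totalUpcrossProb_nonneg hp htrans ..)
        (sub_nonneg.2 (escape_le_one hp htrans ..)), Pi.one_apply, ← ENNReal.ofReal_one]
      refine ENNReal.ofReal_le_ofReal ?_
      have := escape_le_totalUpcrossProb hp htrans hmR v hω
      rw [headI_history] at this
      linarith
  · refine ge_of_tendsto' (x := atTop) (f := fun n => P (history X n ⁻¹' B) +
        ∫⁻ ω, ENNReal.ofReal (1 - escape p R (X n ω)) ∂P) ?_ fun n => ?_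
    · simpa using hlim.add hesc
    · rw [← hV n, ← lintegral_indicator_one₀ (hBm n), ← lintegral_add_left' (hBi n)]
      refine lintegral_mono fun ω => ?_
      by_cases hω : ω ∈ history X n ⁻¹' B
      · rw [Set.indicator_of_mem hω]
        exact le_add_right (ENNReal.ofReal_le_one.2 (totalUpcrossProb_le_one hp htrans ..))
      · have := totalUpcrossProb_le hp htrans m R v hω
        rw [headI_history] at this
        exact le_add_left (ENNReal.ofReal_le_ofReal this)

end Walk

end NNRW

/-- for a transient chain, the total number of upcrossings at `R` is
geometric with parameter `1/D(R,∞)`, and `(ξ(R,∞,↑))_R` is a Markov chain. -/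
theorem stmt9 (p : ℕ → ℝ) (hp : ∀ i, 1 ≤ i → 0 ≤ p i ∧ p i < 1 / 2)
    (htrans : Dinf p 0 < ⊤)
    (Ω : Type) [MeasurableSpace Ω] (P : Measure Ω) [IsProbabilityMeasure P]
    (X : ℕ → Ω → ℕ) (hX : IsNNWalk P X p 0) :
    (∀ R L : ℕ, 1 ≤ L →
      P {ω | upcross X R ω = (L : ℝ≥0∞)} =
        1 / Dinf p R * (1 - 1 / Dinf p R) ^ (L - 1)) ∧
    -- Markov property of the upcrossing sequence
    (∀ (R L : ℕ) (v : ℕ → ℕ),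
      P ({ω | upcross X (R + 1) ω = (L : ℝ≥0∞)} ∩
            {ω | ∀ r ≤ R, upcross X r ω = (v r : ℝ≥0∞)}) *
          P {ω | upcross X R ω = (v R : ℝ≥0∞)} =
        P ({ω | upcross X (R + 1) ω = (L : ℝ≥0∞)} ∩
            {ω | upcross X R ω = (v R : ℝ≥0∞)}) *
          P {ω | ∀ r ≤ R, upcross X r ω = (v r : ℝ≥0∞)}) := by
  refine ⟨fun R L hL => ?_, fun R L v => ?_⟩
  · have h := measure_upcross_eq hp htrans hX (le_refl R) fun _ => L
    have hset : {ω | ∀ r, R ≤ r → r ≤ R → upcross X r ω = (L : ℝ≥0∞)} =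
        {ω | upcross X R ω = (L : ℝ≥0∞)} := by
      ext ω
      exact ⟨fun h => h R le_rfl le_rfl, fun h r h1 h2 => le_antisymm h2 h1 ▸ h⟩
    have hD := tsum_ratioProd_pos hp htrans R
    have hq := sub_nonneg.2 (escape_le_one hp htrans R (R + 1))
    rw [hset] at h
    rw [h, upcrossProb, Finset.Ioc_self, Finset.prod_empty, mul_one, lastWeight,
      if_neg (by lia), escape_of_le (Nat.zero_le R), sub_zero, one_mul,
      ENNReal.ofReal_mul (escape_nonneg hp ..), ENNReal.ofReal_pow hq,
      ENNReal.ofReal_sub _ (escape_nonneg hp ..), escape_succ_self, ENNReal.ofReal_one,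
      ENNReal.ofReal_div_of_pos hD, Dinf_eq hp htrans, ENNReal.ofReal_one]
  · set w : ℕ → ℕ := fun r => if r = R + 1 then L else v r with hw
    have hwR : w (R + 1) = L := if_pos rfl
    have hwr : ∀ r ≤ R, w r = v r := fun r hr => if_neg (by lia)
    have e1 : {ω | upcross X (R + 1) ω = (L : ℝ≥0∞)} ∩
        {ω | ∀ r ≤ R, upcross X r ω = (v r : ℝ≥0∞)} =
        {ω | ∀ r, 0 ≤ r → r ≤ R + 1 → upcross X r ω = (w r : ℝ≥0∞)} := by
      ext ω
      simp only [Set.mem_inter_iff, Set.mem_ofPred_eq]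
      constructor
      · rintro ⟨h1, h2⟩ r - hr
        rcases Nat.le_succ_iff.1 hr with hr | rfl
        · rw [hwr r hr, h2 r hr]
        · rw [hwR, h1]
      · exact fun h => ⟨hwR ▸ h (R + 1) (by lia) le_rfl,
          fun r hr => hwr r hr ▸ h r (by lia) (by lia)⟩
    have e2 : {ω | upcross X (R + 1) ω = (L : ℝ≥0∞)} ∩
        {ω | upcross X R ω = (v R : ℝ≥0∞)} =
        {ω | ∀ r, R ≤ r → r ≤ R + 1 → upcross X r ω = (w r : ℝ≥0∞)} := by
      ext ω
      simp only [Set.mem_inter_iff, Set.mem_ofPred_eq]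
      constructor
      · rintro ⟨h1, h2⟩ r hr' hr
        rcases Nat.le_succ_iff.1 hr with hr | rfl
        · obtain rfl := le_antisymm hr hr'
          rw [hwr r hr, h2]
        · rw [hwR, h1]
      · exact fun h => ⟨hwR ▸ h (R + 1) (by lia) le_rfl, hwr R le_rfl ▸ h R le_rfl (by lia)⟩
    have e3 : {ω | upcross X R ω = (v R : ℝ≥0∞)} =
        {ω | ∀ r, R ≤ r → r ≤ R → upcross X r ω = (w r : ℝ≥0∞)} := by
      ext ω
      exact ⟨fun h r h1 h2 => by obtain rfl := le_antisymm h2 h1; rw [hwr r h2]; exact h,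
        fun h => hwr R le_rfl ▸ h R le_rfl le_rfl⟩
    have e4 : {ω | ∀ r ≤ R, upcross X r ω = (v r : ℝ≥0∞)} =
        {ω | ∀ r, 0 ≤ r → r ≤ R → upcross X r ω = (w r : ℝ≥0∞)} := by
      ext ω
      exact ⟨fun h r _ hr => by rw [hwr r hr]; exact h r hr,
        fun h r hr => hwr r hr ▸ h r (by lia) hr⟩
    rw [e2, e1, e3, e4, measure_upcross_eq hp htrans hX (by lia),
      measure_upcross_eq hp htrans hX le_rfl, measure_upcross_eq hp htrans hX (by lia),
      measure_upcross_eq hp htrans hX (by lia),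
      ← ENNReal.ofReal_mul (upcrossProb_nonneg hp htrans ..),
      ← ENNReal.ofReal_mul (upcrossProb_nonneg hp htrans ..)]
    congr 1
    have hR : Finset.Ioc R (R + 1) = {R + 1} := by ext; simp
    have h0 : Finset.Ioc 0 (R + 1) = insert (R + 1) (Finset.Ioc 0 R) := by ext; simp; lia
    simp only [upcrossProb, Finset.Ioc_self, Finset.prod_empty, hR, Finset.prod_singleton]
    rw [h0, Finset.prod_insert (by simp)]
    ring
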